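/- arXiv:1710.02296 — 2 statements merged into one kernel-verified Lean document; each statement's English description precedes it below -/
import Mathlib

section
/- The operator F = ∫ dψ (|ψ⟩⟨ψ|)^{⊗M} · ⟨ψ|0⟩⟨0|ψ⟩ on Sym^M(ℂ^d) is diagonal in the occupation-number basis {|m⃗⟩} with eigenvalues (m_0+1)/((M+1) d_{M+1}^+), where m⃗ = (m_0,…,m_{d-1}) ranges over nonnegative integer vectors summing to M. -/
open scoped BigOperators

/-- `M`-fold tensor power `|φ⟩^{⊗M}` of a vector `φ ∈ ℂ^d`, as a vector on the
computational product basis `Fin M → Fin d`. -/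
noncomputable def vecPow {d : ℕ} (M : ℕ) (φ : Fin d → ℂ) : (Fin M → Fin d) → ℂ :=
  fun f => ∏ i, φ (f i)

/-- Rank-one operator `|v⟩⟨v|`. -/
noncomputable def projOp {n : Type*} [Fintype n] (v : n → ℂ) : Matrix n n ℂ :=
  Matrix.of fun i j => v i * star (v j)

/-- The orthogonal projector `P_+^M` onto the symmetric subspace of `(ℂ^d)^{⊗M}`. -/
noncomputable def symProj (d M : ℕ) : Matrix (Fin M → Fin d) (Fin M → Fin d) ℂ :=
  Matrix.of fun f g =>
    (∑ σ : Equiv.Perm (Fin M), if f = g ∘ σ then (1 : ℂ) else 0) / (Nat.factorial M : ℂ)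

/-- `d_M^+ = C(M+d-1, M)`, the dimension of the symmetric subspace. -/
def dPlus (d M : ℕ) : ℕ := (M + d - 1).choose M

/-- Occupation numbers of a computational product basis vector. -/
def occ {d M : ℕ} (f : Fin M → Fin d) : Fin d → ℕ :=
  fun i => (Finset.univ.filter fun j => f j = i).card

/-- The normalized occupation-number basis state `|m⃗⟩` of the symmetric
subspace of `(ℂ^d)^{⊗M}` (the symmetric state with `m_i` copies of `|i⟩`). -/
noncomputable def ketOcc (d M : ℕ) (m : Fin d → ℕ) : (Fin M → Fin d) → ℂ :=
  fun f => if occ f = m then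
    (((Real.sqrt ((Finset.univ.filter fun g : Fin M → Fin d => occ g = m).card))⁻¹ : ℝ) : ℂ)
  else 0

open MeasureTheory

namespace FDiag

/-- Monomial `ψ^k`. -/
noncomputable def mon {d : ℕ} (ψ : Fin d → ℂ) (k : Fin d → ℕ) : ℂ := ∏ i, ψ i ^ k i

lemma coeff_unique {d K : ℕ} (a b : (Fin d → ℕ) → ℂ)
    (h : ∀ t : Fin d → ℝ, (∀ i, 0 < t i) →
      ∑ k ∈ Finset.piAntidiag Finset.univ K, a k * mon (fun i => (t i : ℂ)) k =
      ∑ k ∈ Finset.piAntidiag Finset.univ K, b k * mon (fun i => (t i : ℂ)) k)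
    (k : Fin d → ℕ) (hk : ∑ i, k i = K) : a k = b k := by
  classical
  let P : ((Fin d → ℕ) → ℂ) → MvPolynomial (Fin d) ℂ := fun a =>
    ∑ k ∈ Finset.piAntidiag Finset.univ K,
      MvPolynomial.monomial (Finsupp.equivFunOnFinite.symm k) (a k)
  have hev : ∀ a x, MvPolynomial.eval x (P a) =
      ∑ k ∈ Finset.piAntidiag Finset.univ K, a k * mon x k := by
    intro a x
    simp only [P, map_sum, MvPolynomial.eval_monomial]
    refine Finset.sum_congr rfl fun k _ => ?_
    rw [Finsupp.prod_fintype _ _ (by simp)]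
    simp [mon]
  have hco : ∀ a, MvPolynomial.coeff (Finsupp.equivFunOnFinite.symm k) (P a) = a k := by
    intro a
    simp only [P, MvPolynomial.coeff_sum, MvPolynomial.coeff_monomial]
    rw [Finset.sum_eq_single k]
    · simp
    · intro l _ hl
      rw [if_neg]
      simpa using hl
    · intro hk'
      simp [hk] at hk'
  have hPQ : P a = P b := by
    refine MvPolynomial.funext_set (fun _ => (fun x : ℝ => (x : ℂ)) '' Set.Ioi 0) (fun _ => ?_) ?_
    · exact (Set.Ioi_infinite 0).image Complex.ofReal_injective.injOn
    · intro x hx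
      have hx' : ∀ i, ∃ t : ℝ, 0 < t ∧ (t : ℂ) = x i := fun i => by
        simpa using hx i (Set.mem_univ i)
      choose t ht htx using hx'
      have : x = fun i => (t i : ℂ) := funext fun i => (htx i).symm
      rw [hev, hev, this]
      exact h t ht
  rw [← hco a, ← hco b, hPQ]

lemma vecPow_eq {d M : ℕ} (ψ : Fin d → ℂ) (f : Fin M → Fin d) :
    vecPow M ψ f = mon ψ (occ f) := by
  unfold vecPow mon occ
  rw [← Finset.prod_fiberwise Finset.univ f]
  refine Finset.prod_congr rfl fun i _ => ?_
  rw [Finset.prod_congr rfl (g := fun _ => ψ i), Finset.prod_const]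
  intro j hj
  simp at hj
  rw [hj]

lemma sum_occ {d M : ℕ} (f : Fin M → Fin d) : ∑ i, occ f i = M := by
  unfold occ
  rw [← Finset.card_eq_sum_card_fiberwise (fun _ _ => Finset.mem_coe.2 (Finset.mem_univ _))]
  simp

lemma sum_pow_mon {d : ℕ} (K : ℕ) (x : Fin d → ℂ) : (∑ i, x i) ^ K =
    ∑ k ∈ Finset.piAntidiag Finset.univ K, (Nat.multinomial Finset.univ k : ℂ) * mon x k :=
  Finset.sum_pow_eq_sum_piAntidiag _ _ _

lemma card_occ {d M : ℕ} (m : Fin d → ℕ) (hm : ∑ i, m i = M) :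
    ((Finset.univ.filter fun g : Fin M → Fin d => occ g = m).card : ℂ) =
      Nat.multinomial Finset.univ m := by
  refine coeff_unique (K := M)
    (fun m => ((Finset.univ.filter fun g : Fin M → Fin d => occ g = m).card : ℂ))
    (fun m => (Nat.multinomial Finset.univ m : ℂ)) ?_ m hm
  intro t _
  rw [← sum_pow_mon, Finset.sum_pow']
  rw [← Finset.sum_fiberwise_of_maps_to (t := Finset.piAntidiag Finset.univ M) (g := occ)]
  · refine Finset.sum_congr rfl fun k _ => ?_
    rw [Finset.sum_congr (s₂ := Finset.univ.filter fun g : Fin M → Fin d => occ g = k)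
      (g := fun _ => mon (fun i => (t i : ℂ)) k), Finset.sum_const, nsmul_eq_mul]
    · ext; simp
    · intro f hf
      simp at hf
      rw [← hf, ← vecPow_eq]
      rfl
  · intro f _
    simp [sum_occ]

lemma mon_mul {d : ℕ} (x y : Fin d → ℂ) (k) : mon (fun i => x i * y i) k = mon x k * mon y k := by
  simp [mon, mul_pow, Finset.prod_mul_distrib]

lemma mon_star {d : ℕ} (x : Fin d → ℂ) (k) : mon (fun i => star (x i)) k = star (mon x k) := by
  simp [mon]

section meas
variable {d : ℕ} {μ : Measure (Fin d → ℂ)} [IsProbabilityMeasure μ]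

lemma integrable_mon (hsupp : ∀ᵐ ψ ∂μ, ∑ i, ψ i * star (ψ i) = 1) (k l : Fin d → ℕ) :
    Integrable (fun ψ => mon ψ k * star (mon ψ l)) μ := by
  refine Integrable.of_bound (C := 1) ?_ ?_
  · apply Continuous.aestronglyMeasurable
    unfold mon
    fun_prop
  · filter_upwards [hsupp] with ψ h
    have hi : ∀ i, ‖ψ i‖ ≤ 1 := by
      intro i
      have h2 : ∑ i, ‖ψ i‖ ^ 2 = 1 := by
        have : ((∑ i, ‖ψ i‖ ^ 2 : ℝ) : ℂ) = 1 := by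
          rw [← h]; push_cast
          refine Finset.sum_congr rfl fun i _ => ?_
          exact (Complex.mul_conj' _).symm
        exact_mod_cast this
      have := Finset.single_le_sum (f := fun i => ‖ψ i‖ ^ 2) (fun i _ => by positivity)
        (Finset.mem_univ i)
      simp only [h2] at this
      nlinarith [norm_nonneg (ψ i)]
    have hm : ∀ k, ‖mon ψ k‖ ≤ 1 := by
      intro k
      unfold mon
      rw [norm_prod]
      refine Finset.prod_le_one (fun _ _ => norm_nonneg _) fun i _ => ?_
      rw [norm_pow]
      exact pow_le_one₀ (norm_nonneg _) (hi i)
    rw [norm_mul, norm_star]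
    exact mul_le_one₀ (hm k) (norm_nonneg _) (hm l)

lemma integral_inv (hinv : ∀ U : Matrix.unitaryGroup (Fin d) ℂ,
      Measure.map (fun ψ => Matrix.mulVec (U : Matrix (Fin d) (Fin d) ℂ) ψ) μ = μ)
    (U : Matrix.unitaryGroup (Fin d) ℂ) (F : (Fin d → ℂ) → ℂ) (hF : Continuous F) :
    ∫ ψ, F (Matrix.mulVec (U : Matrix (Fin d) (Fin d) ℂ) ψ) ∂μ = ∫ ψ, F ψ ∂μ := by
  conv_rhs => rw [← hinv U]
  rw [integral_map]
  · exact (Continuous.measurable (by fun_prop)).aemeasurable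
  · exact hF.aestronglyMeasurable

lemma cont_mon (k : Fin d → ℕ) : Continuous (fun ψ : Fin d → ℂ => mon ψ k) := by
  unfold mon; fun_prop

lemma offdiag (hinv : ∀ U : Matrix.unitaryGroup (Fin d) ℂ,
      Measure.map (fun ψ => Matrix.mulVec (U : Matrix (Fin d) (Fin d) ℂ) ψ) μ = μ)
    (k l : Fin d → ℕ) (hkl : k ≠ l) : ∫ ψ, mon ψ k * star (mon ψ l) ∂μ = 0 := by
  obtain ⟨i, hi⟩ := Function.ne_iff.1 hkl
  set θ : ℝ := Real.pi / ((k i : ℝ) - l i) with hθ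
  set z : ℂ := Complex.exp (θ * Complex.I) with hz
  have hzs : star z = Complex.exp (-(θ * Complex.I)) := by
    rw [hz, ← starRingEnd_apply, ← Complex.exp_conj]; simp
  have hz1 : z * star z = 1 := by rw [hzs, hz, ← Complex.exp_add]; simp
  let w : Fin d → ℂ := Function.update 1 i z
  have hw : ∀ j, w j * star (w j) = 1 := by
    intro j
    by_cases h : j = i
    · subst h; simpa [w] using hz1
    · simp [w, h]
  have hU : Matrix.diagonal w ∈ Matrix.unitaryGroup (Fin d) ℂ := by
    rw [Matrix.mem_unitaryGroup_iff, Matrix.star_eq_conjTranspose, Matrix.diagonal_conjTranspose,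
      Matrix.diagonal_mul_diagonal, ← Matrix.diagonal_one]
    congr 1
    funext j
    simpa using hw j
  have hmw : ∀ k : Fin d → ℕ, mon w k = z ^ k i := by
    intro k
    unfold mon
    rw [Finset.prod_eq_single i]
    · simp [w]
    · intro j _ hj; simp [w, hj]
    · simp
  have hne : (k i : ℝ) - l i ≠ 0 := by
    rw [sub_ne_zero]; exact_mod_cast hi
  have hm1 : z ^ k i * star (z ^ l i) = -1 := by
    rw [star_pow, hzs, hz, ← Complex.exp_nat_mul, ← Complex.exp_nat_mul, ← Complex.exp_add,
      ← Complex.exp_pi_mul_I]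
    congr 1
    have : (Real.pi : ℂ) = ((k i : ℂ) - l i) * θ := by
      have : Real.pi = ((k i : ℝ) - l i) * θ := by rw [hθ]; field_simp
      have h' := congrArg (fun x : ℝ => (x : ℂ)) this
      simpa using h'
    rw [this]; ring
  have key := integral_inv hinv ⟨_, hU⟩ (fun ψ => mon ψ k * star (mon ψ l))
    ((cont_mon k).mul (cont_mon l).star)
  have hmv : ∀ ψ k, mon (Matrix.mulVec (Matrix.diagonal w) ψ) k = mon w k * mon ψ k := by
    intro ψ k
    rw [← mon_mul]
    congr 1
    funext j
    exact Matrix.mulVec_diagonal _ _ _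
  simp only [hmv, hmw] at key
  have : ∀ ψ, z ^ k i * mon ψ k * star (z ^ l i * mon ψ l) = -1 * (mon ψ k * star (mon ψ l)) := by
    intro ψ
    rw [← hm1, star_mul']; ring
  simp only [this] at key
  rw [integral_const_mul] at key
  linear_combination (-1/2 : ℂ) * key

lemma exists_unitary (i0 : Fin d) (u : Fin d → ℂ) (hu : ∑ i, u i * star (u i) = 1) :
    ∃ U : Matrix.unitaryGroup (Fin d) ℂ, ∀ j, (U : Matrix (Fin d) (Fin d) ℂ) i0 j = u j := by
  have hin : ∀ x y : EuclideanSpace ℂ (Fin d), inner ℂ x y = ∑ j, y j * star (x j) := by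
    intro x y
    rw [PiLp.inner_apply]
    simp
  let v : EuclideanSpace ℂ (Fin d) := WithLp.toLp 2 u
  have hv : inner ℂ v v = (1 : ℂ) := by rw [hin]; exact hu
  have hv' : ‖v‖ = 1 := by
    have := inner_self_eq_norm_sq_to_K (𝕜 := ℂ) v
    rw [hv] at this
    have h2 : ‖v‖ ^ 2 = 1 := by
      have h3 : (((‖v‖ ^ 2 : ℝ)) : ℂ) = 1 := by rw [this]; simp
      exact_mod_cast h3
    nlinarith [norm_nonneg v]
  obtain ⟨b, hb⟩ := Orthonormal.exists_orthonormalBasis_extension_of_card_eq (𝕜 := ℂ)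
    (E := EuclideanSpace ℂ (Fin d)) (ι := Fin d) (by simp) (v := fun _ => v) (s := {i0}) (by
      constructor
      · intro i; simpa using hv'
      · intro i j hij
        exact absurd (Subsingleton.elim i j) hij)
  refine ⟨⟨Matrix.of fun i j => b i j, ?_⟩, ?_⟩
  · rw [Matrix.mem_unitaryGroup_iff]
    ext i j
    have := orthonormal_iff_ite.1 b.orthonormal j i
    rw [hin] at this
    rw [Matrix.mul_apply, Matrix.one_apply]
    simp only [Matrix.star_apply, Matrix.of_apply]
    rw [this]
    simp [eq_comm]
  · intro j
    have := hb i0 rfl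
    simp [this, v]

lemma integral_pow (hinv : ∀ U : Matrix.unitaryGroup (Fin d) ℂ,
      Measure.map (fun ψ => Matrix.mulVec (U : Matrix (Fin d) (Fin d) ℂ) ψ) μ = μ)
    (i0 : Fin d) (K : ℕ) (t : Fin d → ℝ) (ht : ∀ i, 0 < t i) :
    ∫ ψ, (∑ i, (Real.sqrt (t i) : ℂ) * ψ i) ^ K * star ((∑ i, (Real.sqrt (t i) : ℂ) * ψ i) ^ K) ∂μ
      = (∑ i, (t i : ℂ)) ^ K * ∫ ψ, ψ i0 ^ K * star (ψ i0 ^ K) ∂μ := by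
  set T : ℝ := ∑ i, t i with hT
  have hTpos : 0 < T := Finset.sum_pos (fun i _ => ht i) ⟨i0, Finset.mem_univ _⟩
  have hs : (Real.sqrt T : ℂ) * Real.sqrt T = T := by
    rw [← Complex.ofReal_mul, Real.mul_self_sqrt hTpos.le]
  have hs0 : (Real.sqrt T : ℂ) ≠ 0 := by
    exact_mod_cast (Real.sqrt_pos.2 hTpos).ne'
  obtain ⟨U, hU⟩ := exists_unitary i0 (fun i => (Real.sqrt (t i) : ℂ) / Real.sqrt T) (by
    have : ∀ i, (Real.sqrt (t i) : ℂ) / Real.sqrt T * star ((Real.sqrt (t i) : ℂ) / Real.sqrt T)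
        = (t i : ℂ) / T := by
      intro i
      rw [← hs, ← Complex.ofReal_div, ← starRingEnd_apply, Complex.conj_ofReal]
      rw [Complex.ofReal_div, div_mul_div_comm, ← Complex.ofReal_mul (√(t i)),
        Real.mul_self_sqrt (ht i).le]
    simp only [this]
    rw [← Finset.sum_div, ← Complex.ofReal_sum, ← hT, div_self]
    exact_mod_cast hTpos.ne')
  have key := integral_inv hinv U (fun ψ => ψ i0 ^ K * star (ψ i0 ^ K)) (by fun_prop)
  rw [← key, ← integral_const_mul]
  congr 1
  funext ψ
  have h1 : (∑ i, (Real.sqrt (t i) : ℂ) * ψ i) =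
      (Real.sqrt T : ℂ) * Matrix.mulVec (U : Matrix (Fin d) (Fin d) ℂ) ψ i0 := by
    rw [Matrix.mulVec, dotProduct, Finset.mul_sum]
    refine Finset.sum_congr rfl fun i _ => ?_
    rw [hU]; field_simp
  rw [h1, ← Complex.ofReal_sum, ← hT, ← hs]
  have h2 : star (Real.sqrt T : ℂ) = Real.sqrt T := Complex.conj_ofReal _
  simp only [mul_pow, star_mul', star_pow, h2]
  ring

lemma moment (hsupp : ∀ᵐ ψ ∂μ, ∑ i, ψ i * star (ψ i) = 1)
    (hinv : ∀ U : Matrix.unitaryGroup (Fin d) ℂ,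
      Measure.map (fun ψ => Matrix.mulVec (U : Matrix (Fin d) (Fin d) ℂ) ψ) μ = μ)
    (i0 : Fin d) (K : ℕ) (k : Fin d → ℕ) (hk : ∑ i, k i = K) :
    (Nat.multinomial Finset.univ k : ℂ) * ∫ ψ, mon ψ k * star (mon ψ k) ∂μ =
      ∫ ψ, ψ i0 ^ K * star (ψ i0 ^ K) ∂μ := by
  set c := ∫ ψ, ψ i0 ^ K * star (ψ i0 ^ K) ∂μ with hc
  have h := coeff_unique (K := K)
    (fun k => (Nat.multinomial Finset.univ k : ℂ) ^ 2 * ∫ ψ, mon ψ k * star (mon ψ k) ∂μ)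
    (fun k => c * (Nat.multinomial Finset.univ k : ℂ)) (fun t ht => by
      have h1 := integral_pow hinv i0 K t ht
      rw [← hc, sum_pow_mon] at h1
      have h2 : ∀ ψ : Fin d → ℂ,
          (∑ i, (Real.sqrt (t i) : ℂ) * ψ i) ^ K * star ((∑ i, (Real.sqrt (t i) : ℂ) * ψ i) ^ K) =
          ∑ k ∈ Finset.piAntidiag Finset.univ K, ∑ l ∈ Finset.piAntidiag Finset.univ K,
            ((Nat.multinomial Finset.univ k : ℂ) * mon (fun i => (Real.sqrt (t i) : ℂ)) k *
            ((Nat.multinomial Finset.univ l : ℂ) * mon (fun i => (Real.sqrt (t i) : ℂ)) l)) *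
            (mon ψ k * star (mon ψ l)) := by
        intro ψ
        rw [sum_pow_mon, star_sum, Finset.sum_mul_sum]
        refine Finset.sum_congr rfl fun k _ => Finset.sum_congr rfl fun l _ => ?_
        have h3 : star (mon (fun i => (Real.sqrt (t i) : ℂ)) l) =
            mon (fun i => (Real.sqrt (t i) : ℂ)) l := by
          rw [← mon_star]
          congr 1
          funext i
          exact Complex.conj_ofReal _
        rw [mon_mul, mon_mul]
        simp only [star_mul', h3, star_natCast]
        ring
      simp only [h2] at h1
      rw [integral_finsetSum _ (fun k _ => integrable_finsetSum _ fun l _ =>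
        (integrable_mon hsupp k l).const_mul _)] at h1
      simp only [mul_assoc c]
      rw [← Finset.mul_sum, mul_comm c, ← h1]
      refine Finset.sum_congr rfl fun k hk => ?_
      rw [integral_finsetSum _ (fun l _ => (integrable_mon hsupp k l).const_mul _)]
      rw [Finset.sum_eq_single k]
      · rw [integral_const_mul]
        have : mon (fun i => (t i : ℂ)) k = mon (fun i => (Real.sqrt (t i) : ℂ)) k *
            mon (fun i => (Real.sqrt (t i) : ℂ)) k := by
          rw [← mon_mul]
          congr 1
          funext i
          rw [← Complex.ofReal_mul, Real.mul_self_sqrt (ht i).le]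
        rw [this]; ring
      · intro l _ hl
        rw [integral_const_mul, offdiag hinv k l hl.symm, mul_zero]
      · intro h; exact absurd hk h) k hk
  have hpos : (Nat.multinomial Finset.univ k : ℂ) ≠ 0 := by
    exact_mod_cast (Nat.multinomial_pos _ _).ne'
  apply mul_left_cancel₀ hpos
  linear_combination h

lemma card_anti (K : ℕ) :
    (Finset.piAntidiag (Finset.univ : Finset (Fin d)) K).card = (d + K - 1).choose K := by
  have := Finset.card_finsuppAntidiag_nat_eq_choose (s := (Finset.univ : Finset (Fin d))) K
  rw [Finset.card_univ, Fintype.card_fin] at this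
  rw [← this]
  refine Finset.card_bij' (fun k _ => Finsupp.equivFunOnFinite.symm k) (fun k _ => ⇑k) ?_ ?_ ?_ ?_
  · intro k hk; simpa using hk
  · intro k hk; simpa using hk
  · intro k hk; simp
  · intro k hk; ext; simp

lemma const_val (hsupp : ∀ᵐ ψ ∂μ, ∑ i, ψ i * star (ψ i) = 1)
    (hinv : ∀ U : Matrix.unitaryGroup (Fin d) ℂ,
      Measure.map (fun ψ => Matrix.mulVec (U : Matrix (Fin d) (Fin d) ℂ) ψ) μ = μ)
    (i0 : Fin d) (K : ℕ) :
    ((d + K - 1).choose K : ℂ) * ∫ ψ, ψ i0 ^ K * star (ψ i0 ^ K) ∂μ = 1 := by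
  have h1 : ∫ ψ, (∑ i, ψ i * star (ψ i)) ^ K ∂μ = 1 := by
    rw [integral_congr_ae (g := fun _ => (1 : ℂ))]
    · simp
    · filter_upwards [hsupp] with ψ h
      rw [h, one_pow]
  rw [← h1]
  simp only [sum_pow_mon, mon_mul, mon_star]
  rw [integral_finsetSum _ (fun k _ => (integrable_mon hsupp k k).const_mul _)]
  simp only [integral_const_mul]
  rw [Finset.sum_congr rfl fun k hk => moment hsupp hinv i0 K k (by simpa using hk)]
  rw [Finset.sum_const, nsmul_eq_mul, card_anti]

end meas

end FDiag

open FDiag in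
/-- The operator `F = ∫dψ (|ψ⟩⟨ψ|)^{⊗M} ⟨ψ|0⟩⟨0|ψ⟩` is diagonal in the
occupation-number basis, with eigenvalues `(m_0+1)/((M+1) d_{M+1}^+)`. -/
theorem F_diagonal (d M : ℕ) (hd : 0 < d) (μ : Measure (Fin d → ℂ))
    [IsProbabilityMeasure μ]
    (hsupp : ∀ᵐ ψ ∂μ, ∑ i, ψ i * star (ψ i) = 1)
    (hinv : ∀ U : Matrix.unitaryGroup (Fin d) ℂ,
      Measure.map (fun ψ => Matrix.mulVec (U : Matrix (Fin d) (Fin d) ℂ) ψ) μ = μ)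
    (m n : Fin d → ℕ) (hm : ∑ i, m i = M) (hn : ∑ i, n i = M) :
    ∑ f : Fin M → Fin d, ∑ g : Fin M → Fin d,
      star (ketOcc d M m f) *
        (∫ ψ, vecPow M ψ f * star (vecPow M ψ g) *
          (ψ ⟨0, hd⟩ * star (ψ ⟨0, hd⟩)) ∂μ) *
        ketOcc d M n g
      = if m = n then
          ((m ⟨0, hd⟩ + 1 : ℕ) : ℂ) / (((M + 1) * dPlus d (M + 1) : ℕ) : ℂ)
        else 0 := by
  set i0 : Fin d := ⟨0, hd⟩ with hi0
  let e : (Fin d → ℕ) → (Fin d → ℕ) := fun k => k + Pi.single i0 1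
  have hmon : ∀ (ψ : Fin d → ℂ) k, mon ψ (e k) = mon ψ k * ψ i0 := by
    intro ψ k
    simp only [mon, e, Pi.add_apply, pow_add, Finset.prod_mul_distrib]
    congr 1
    rw [Finset.prod_eq_single i0]
    · simp
    · intro j _ hj; simp [hj]
    · simp
  have hI : ∀ f g : Fin M → Fin d, (∫ ψ, vecPow M ψ f * star (vecPow M ψ g) *
      (ψ i0 * star (ψ i0)) ∂μ) = ∫ ψ, mon ψ (e (occ f)) * star (mon ψ (e (occ g))) ∂μ := by
    intro f g
    congr 1
    funext ψ
    rw [vecPow_eq, vecPow_eq, hmon, hmon, star_mul']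
    ring
  simp only [hI]
  split_ifs with hmn
  · subst hmn
    set N := (Finset.univ.filter fun g : Fin M → Fin d => occ g = m).card with hN
    set r : ℂ := (((Real.sqrt N)⁻¹ : ℝ) : ℂ) with hr
    have hNm : (N : ℂ) = Nat.multinomial Finset.univ m := card_occ m hm
    have hN0 : (N : ℂ) ≠ 0 := by
      rw [hNm]; exact_mod_cast (Nat.multinomial_pos _ _).ne'
    have hrr : r * r * N = 1 := by
      have hNr : (N : ℝ) ≠ 0 := by exact_mod_cast hN0
      have : (Real.sqrt N)⁻¹ * (Real.sqrt N)⁻¹ * (N : ℝ) = 1 := by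
        rw [← mul_inv, Real.mul_self_sqrt (by positivity), inv_mul_cancel₀ hNr]
      rw [hr]
      exact_mod_cast this
    set E := ∫ ψ, mon ψ (e m) * star (mon ψ (e m)) ∂μ with hE
    have hterm : ∀ f g : Fin M → Fin d, star (ketOcc d M m f) *
        (∫ ψ, mon ψ (e (occ f)) * star (mon ψ (e (occ g))) ∂μ) * ketOcc d M m g =
        (if occ f = m then 1 else 0) * ((if occ g = m then 1 else 0) * (r * r * E)) := by
      intro f g
      unfold ketOcc
      by_cases hf : occ f = m
      · by_cases hg : occ g = m
        · rw [if_pos hf, if_pos hg, hf, hg, ← hN, ← hr, ← hE,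
            show star r = r from Complex.conj_ofReal _]
          simp [hf, hg]; ring
        · simp [hg]
      · simp [hf]
    simp only [hterm]
    simp only [← Finset.mul_sum, ← Finset.sum_mul, Finset.sum_boole]
    rw [← hN]
    have hsum : ∑ i, e m i = M + 1 := by
      simp [e, Finset.sum_add_distrib, hm]
    have h1 := moment hsupp hinv i0 (M + 1) (e m) hsum
    have h2 := const_val hsupp hinv i0 (M + 1)
    rw [← h1, ← hE] at h2
    have hdp : dPlus d (M + 1) = (d + (M + 1) - 1).choose (M + 1) := by
      unfold dPlus; rw [add_comm d]
    rw [← hdp] at h2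
    have h3 : (m i0 + 1) * Nat.multinomial Finset.univ (e m) =
        (M + 1) * Nat.multinomial Finset.univ m := by
      have s1 := Nat.multinomial_spec Finset.univ m
      have s2 := Nat.multinomial_spec Finset.univ (e m)
      rw [hsum, Nat.factorial_succ, ← hm, ← s1, hm] at s2
      have hp : ∏ i, (e m i).factorial = (m i0 + 1) * ∏ i, (m i).factorial := by
        rw [← Finset.mul_prod_erase _ _ (Finset.mem_univ i0),
          ← Finset.mul_prod_erase _ (fun i => (m i).factorial) (Finset.mem_univ i0)]
        rw [Finset.prod_congr rfl (g := fun i => (m i).factorial)]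
        · simp [e, Nat.factorial_succ]; ring
        · intro j hj
          simp [e, Finset.ne_of_mem_erase hj]
      rw [hp] at s2
      have hpos : 0 < ∏ i, (m i).factorial := Finset.prod_pos fun i _ => Nat.factorial_pos _
      apply Nat.eq_of_mul_eq_mul_left hpos
      linarith
    have h3' : ((m i0 : ℂ) + 1) * Nat.multinomial Finset.univ (e m) =
        (M + 1) * Nat.multinomial Finset.univ m := by exact_mod_cast h3
    have hD : (dPlus d (M + 1) : ℂ) ≠ 0 := left_ne_zero_of_mul_eq_one h2
    have hM : ((M : ℂ) + 1) ≠ 0 := by exact_mod_cast Nat.succ_ne_zero M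
    push_cast
    rw [eq_div_iff (mul_ne_zero hM hD)]
    have h4 : (N : ℂ) * (N * (r * r * E)) = N * E := by linear_combination (N * E) * hrr
    rw [h4, hNm]
    linear_combination (-(E * dPlus d (M + 1))) * h3' + ((m i0 : ℂ) + 1) * h2
  · refine Finset.sum_eq_zero fun f _ => Finset.sum_eq_zero fun g _ => ?_
    unfold ketOcc
    by_cases hf : occ f = m
    · by_cases hg : occ g = n
      · rw [hf, hg, offdiag hinv (e m) (e n) (fun h => hmn (add_right_cancel h))]
        simp
      · simp [hg]
    · simp [hf]
end

section
/- For any POVM {O_r} on Sym^M(ℂ^d) with guess states |Φ_r⟩ ∈ Sym^M(ℂ^d), the mean estimation fidelity f̄ = ∫ dψ Σ_r Tr[O_r |ψ⟩⟨ψ|^{⊗M}] · ⟨ψ|Tr_{M-1}(|Φ_r⟩⟨Φ_r|)|ψ⟩ satisfies f̄ ≤ (M+1)/(M+d). -/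
open scoped BigOperators

open MeasureTheory
open scoped ComplexOrder

/-- The multiset of values of `f`. -/
def cls {d K : ℕ} (f : Fin K → Fin d) : Multiset (Fin d) := (Finset.univ : Finset (Fin K)).val.map f

/-- Number of words with the same multiset of values as `f`. -/
def ncl {d K : ℕ} (f : Fin K → Fin d) : ℕ := (Finset.univ.filter fun g : Fin K → Fin d => cls g = cls f).card

lemma ncl_pos {d K : ℕ} (f : Fin K → Fin d) : 0 < ncl f :=
  Finset.card_pos.mpr ⟨f, by simp⟩

lemma ncl_congr {d K : ℕ} {f g : Fin K → Fin d} (h : cls f = cls g) : ncl f = ncl g := by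
  unfold ncl; rw [h]

lemma cls_comp {d K : ℕ} (f : Fin K → Fin d) (σ : Equiv.Perm (Fin K)) : cls (f ∘ σ) = cls f := by
  unfold cls
  rw [← Multiset.map_map]
  congr 1
  exact Multiset.map_univ_val_equiv σ

lemma count_cls {d K : ℕ} (f : Fin K → Fin d) (i : Fin d) :
    (cls f).count i = Fintype.card {k // f k = i} := by
  unfold cls
  rw [Multiset.count_map, Fintype.card_subtype]
  simp only [eq_comm]
  rfl

lemma exists_perm {d K : ℕ} {f g : Fin K → Fin d} (h : cls f = cls g) :
    ∃ σ : Equiv.Perm (Fin K), f ∘ σ = g := by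
  have e : ∀ i, Nonempty ({k // g k = i} ≃ {k // f k = i}) := fun i => by
    rw [← Fintype.card_eq, ← count_cls, ← count_cls, h]
  let e' := fun i => (e i).some
  refine ⟨(Equiv.sigmaFiberEquiv g).symm.trans ((Equiv.sigmaCongrRight e').trans (Equiv.sigmaFiberEquiv f)), ?_⟩
  funext k
  simp only [Function.comp]
  exact (e' (g k) ⟨k, rfl⟩).2

lemma stab_mul {d K : ℕ} (f : Fin K → Fin d) :
    (Finset.univ.filter fun σ : Equiv.Perm (Fin K) => f = f ∘ σ).card * ncl f = K.factorial := by
  have h1 : (Finset.univ : Finset (Equiv.Perm (Fin K))).card = K.factorial := by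
    rw [Finset.card_univ, Fintype.card_perm, Fintype.card_fin]
  rw [← h1]
  conv_rhs => rw [Finset.card_eq_sum_card_fiberwise
    (f := fun σ : Equiv.Perm (Fin K) => f ∘ σ)
    (t := Finset.univ.filter fun g : Fin K → Fin d => cls g = cls f)
    (fun σ _ => by simp [cls_comp])]
  rw [Finset.sum_congr rfl (s₁ := Finset.univ.filter fun g : Fin K → Fin d => cls g = cls f) (g := fun _ => (Finset.univ.filter fun σ : Equiv.Perm (Fin K) => f = f ∘ σ).card)]
  · rw [Finset.sum_const, smul_eq_mul, mul_comm]; rfl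
  · intro g hg
    obtain ⟨τ, rfl⟩ := exists_perm (Finset.mem_filter.mp hg).2.symm
    refine Finset.card_bij' (fun σ _ => σ * τ⁻¹) (fun σ _ => σ * τ) ?_ ?_ ?_ ?_
    · intro σ hσ
      simp only [Finset.mem_filter, Finset.mem_univ, true_and] at hσ ⊢
      funext k
      have := congrFun hσ (τ⁻¹ k)
      simpa using this.symm
    · intro σ hσ
      simp only [Finset.mem_filter, Finset.mem_univ, true_and] at hσ ⊢
      funext k
      have := congrFun hσ (τ k)
      simpa using this.symm
    · intro σ _; simp
    · intro σ _; simp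

lemma sum_inv_ncl (d K : ℕ) : ∑ f : Fin K → Fin d, (1 : ℝ) / ncl f = (d + K - 1).choose K := by
  classical
  have hc : Fintype.card (Sym (Fin d) K) = (d + K - 1).choose K := by
    rw [Sym.card_sym_eq_choose, Fintype.card_fin]
  let F : (Fin K → Fin d) → Sym (Fin d) K := fun f => ⟨cls f, by simp [cls]⟩
  rw [← hc, ← Finset.sum_fiberwise (s := Finset.univ) (g := F)]
  rw [Finset.sum_congr rfl (g := fun _ => (1 : ℝ))]
  · simp
  · intro s _
    obtain ⟨f, rfl⟩ : ∃ f, F f = s := by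
      obtain ⟨m, hm⟩ := s
      induction m using Quotient.inductionOn with
      | h l =>
        have hl : l.length = K := hm
        subst hl
        refine ⟨l.get, Subtype.ext ?_⟩
        simp only [F, cls]
        change Multiset.map l.get (Finset.univ.val) = (l : Multiset (Fin d))
        rw [Fin.univ_val_map, List.ofFn_get]
    have hF : ∀ g, F g = F f ↔ cls g = cls f := fun g => Subtype.ext_iff
    simp only [hF]
    rw [Finset.sum_congr rfl (g := fun _ => (1 : ℝ) / ncl f)]
    · rw [Finset.sum_const, nsmul_eq_mul]
      have := ncl_pos f
      change (ncl f : ℝ) * _ = 1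
      field_simp
    · intro g hg
      rw [ncl_congr (Finset.mem_filter.mp hg).2]

lemma trace_symProj (d K : ℕ) : (symProj d K).trace = (((d + K - 1).choose K : ℕ) : ℂ) := by
  have := sum_inv_ncl d K
  have h2 : (((d + K - 1).choose K : ℕ) : ℂ) = ((∑ f : Fin K → Fin d, (1 : ℝ) / ncl f : ℝ) : ℂ) := by
    rw [this]; simp
  rw [h2]
  push_cast
  unfold Matrix.trace symProj
  refine Finset.sum_congr rfl fun f _ => ?_
  simp only [Matrix.diag, Matrix.of_apply]
  rw [Finset.sum_boole, ← stab_mul f]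
  have h1 := ncl_pos f
  have h3 : 0 < (Finset.univ.filter fun σ : Equiv.Perm (Fin K) => f = f ∘ σ).card :=
    Finset.card_pos.mpr ⟨1, by simp⟩
  push_cast
  have h1' : (ncl f : ℂ) ≠ 0 := by exact_mod_cast h1.ne'
  have h3' : ((Finset.univ.filter fun σ : Equiv.Perm (Fin K) => f = f ∘ σ).card : ℂ) ≠ 0 := by exact_mod_cast h3.ne'
  field_simp

lemma vecPow_eq {d K : ℕ} (ψ : Fin d → ℂ) (f : Fin K → Fin d) :
    vecPow K ψ f = ((cls f).map ψ).prod := by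
  unfold vecPow cls
  rw [Multiset.map_map]; rfl

lemma vecPow_congr {d K : ℕ} (ψ : Fin d → ℂ) {f g : Fin K → Fin d} (h : cls f = cls g) :
    vecPow K ψ f = vecPow K ψ g := by
  rw [vecPow_eq, vecPow_eq, h]

lemma continuous_vecPow {d K : ℕ} (f : Fin K → Fin d) :
    Continuous fun ψ : Fin d → ℂ => vecPow K ψ f := by
  unfold vecPow; fun_prop

lemma integrable_cont {d : ℕ} {μ : Measure (Fin d → ℂ)} [IsProbabilityMeasure μ]
    (hsupp : ∀ᵐ ψ ∂μ, ∑ i, ψ i * star (ψ i) = 1) {E : Type*} [NormedAddCommGroup E]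
    [SecondCountableTopology E]
    {F : (Fin d → ℂ) → E} (hF : Continuous F) : Integrable F μ := by
  obtain ⟨C, hC⟩ := (isCompact_closedBall (0 : Fin d → ℂ) 1).exists_bound_of_continuousOn
    hF.continuousOn
  borelize E
  refine Integrable.of_bound hF.measurable.aestronglyMeasurable C ?_
  filter_upwards [hsupp] with ψ hψ
  apply hC
  rw [mem_closedBall_zero_iff, pi_norm_le_iff_of_nonneg zero_le_one]
  intro i
  have h2 : ∑ i, ‖ψ i‖ ^ 2 = 1 := by
    have : ((∑ i, ‖ψ i‖ ^ 2 : ℝ) : ℂ) = 1 := by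
      rw [← hψ]; push_cast
      refine Finset.sum_congr rfl fun i _ => ?_
      exact (Complex.mul_conj' _).symm
    exact_mod_cast this
  have h3 : ‖ψ i‖ ^ 2 ≤ 1 := by
    rw [← h2]
    exact Finset.single_le_sum (f := fun i => ‖ψ i‖ ^ 2) (fun _ _ => by positivity) (Finset.mem_univ i)
  nlinarith [norm_nonneg (ψ i)]

lemma integral_unitary_inv {d : ℕ} {μ : Measure (Fin d → ℂ)} [IsProbabilityMeasure μ]
    (hinv : ∀ U : Matrix.unitaryGroup (Fin d) ℂ,
      Measure.map (fun ψ => Matrix.mulVec (U : Matrix (Fin d) (Fin d) ℂ) ψ) μ = μ)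
    {E : Type*} [NormedAddCommGroup E] [NormedSpace ℝ E] [SecondCountableTopology E]
    {F : (Fin d → ℂ) → E} (hF : Continuous F) (U : Matrix (Fin d) (Fin d) ℂ)
    (hU : U ∈ Matrix.unitaryGroup (Fin d) ℂ) :
    ∫ ψ, F (U.mulVec ψ) ∂μ = ∫ ψ, F ψ ∂μ := by
  borelize E
  conv_rhs => rw [← hinv ⟨U, hU⟩]
  rw [integral_map]
  · have : Continuous fun ψ : Fin d → ℂ => U.mulVec ψ := by fun_prop
    exact this.measurable.aemeasurable
  · exact hF.measurable.aestronglyMeasurable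

lemma offdiag {d K : ℕ} {μ : Measure (Fin d → ℂ)} [IsProbabilityMeasure μ]
    (hinv : ∀ U : Matrix.unitaryGroup (Fin d) ℂ,
      Measure.map (fun ψ => Matrix.mulVec (U : Matrix (Fin d) (Fin d) ℂ) ψ) μ = μ)
    {f g : Fin K → Fin d} (h : cls f ≠ cls g) :
    ∫ ψ, vecPow K ψ f * star (vecPow K ψ g) ∂μ = 0 := by
  obtain ⟨i, hi⟩ : ∃ i, (cls f).count i ≠ (cls g).count i := by
    by_contra! hc
    exact h (Multiset.ext.mpr hc)
  set a := (cls f).count i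
  set b := (cls g).count i
  have hab : ((a : ℂ) - b) ≠ 0 := by
    rw [sub_ne_zero]; exact_mod_cast hi
  set θ : ℂ := Real.pi * Complex.I / ((a : ℂ) - b) with hθ
  have hsθ : star θ = -θ := by
    rw [hθ]; simp [neg_div]
  let z : Fin d → ℂ := fun j => if j = i then Complex.exp θ else 1
  have hzU : Matrix.diagonal z ∈ Matrix.unitaryGroup (Fin d) ℂ := by
    rw [Matrix.mem_unitaryGroup_iff, Matrix.star_eq_conjTranspose, Matrix.diagonal_conjTranspose,
      Matrix.diagonal_mul_diagonal, ← Matrix.diagonal_one]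
    congr 1
    funext j
    simp only [z, Pi.star_apply]
    split_ifs
    · have : star (Complex.exp θ) = Complex.exp (star θ) := (Complex.exp_conj θ).symm
      rw [this, hsθ, ← Complex.exp_add]; simp
    · simp
  have hv : ∀ (f : Fin K → Fin d) (ψ : Fin d → ℂ), vecPow K ((Matrix.diagonal z).mulVec ψ) f
      = Complex.exp θ ^ (cls f).count i * vecPow K ψ f := by
    intro f ψ
    unfold vecPow
    simp only [Matrix.mulVec_diagonal, Finset.prod_mul_distrib]
    congr 1
    rw [count_cls]
    simp only [z]
    rw [Finset.prod_ite]
    simp [Fintype.card_subtype]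
  have hcont : Continuous fun ψ : Fin d → ℂ => vecPow K ψ f * star (vecPow K ψ g) :=
    (continuous_vecPow f).mul (continuous_vecPow g).star
  have key := integral_unitary_inv hinv hcont _ hzU
  have : ∀ ψ : Fin d → ℂ, vecPow K ((Matrix.diagonal z).mulVec ψ) f *
      star (vecPow K ((Matrix.diagonal z).mulVec ψ) g) = (-1) * (vecPow K ψ f * star (vecPow K ψ g)) := by
    intro ψ
    have hph : Complex.exp θ ^ a * star (Complex.exp θ ^ b) = -1 := by
      have : star (Complex.exp θ) = Complex.exp (star θ) := (Complex.exp_conj θ).symm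
      rw [star_pow, this, hsθ, ← Complex.exp_nat_mul, ← Complex.exp_nat_mul, ← Complex.exp_add,
        ← Complex.exp_pi_mul_I]
      congr 1
      rw [hθ]; field_simp; ring
    rw [hv, hv, star_mul', ← hph]
    ring
  simp only [this] at key
  rw [integral_const_mul] at key
  linear_combination (-1/2) * key

/-- Squared-modulus moments. -/
noncomputable def mom {d K : ℕ} (μ : Measure (Fin d → ℂ)) (f : Fin K → Fin d) : ℝ :=
  ∫ ψ, ‖vecPow K ψ f‖ ^ 2 ∂μ

lemma mom_congr {d K : ℕ} (μ : Measure (Fin d → ℂ)) {f g : Fin K → Fin d} (h : cls f = cls g) :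
    mom μ f = mom μ g := by
  unfold mom; simp only [vecPow_congr _ h]

lemma quad {d K : ℕ} {μ : Measure (Fin d → ℂ)} [IsProbabilityMeasure μ]
    (hsupp : ∀ᵐ ψ ∂μ, ∑ i, ψ i * star (ψ i) = 1)
    (hinv : ∀ U : Matrix.unitaryGroup (Fin d) ℂ,
      Measure.map (fun ψ => Matrix.mulVec (U : Matrix (Fin d) (Fin d) ℂ) ψ) μ = μ)
    (w : (Fin K → Fin d) → ℂ) :
    ∫ ψ, ‖∑ f, w f * vecPow K ψ f‖ ^ 2 ∂μ =
      ∑ f, ∑ g, if cls f = cls g then (w f * star (w g)).re * mom μ f else 0 := by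
  have hcont : ∀ f g : Fin K → Fin d, Continuous fun ψ : Fin d → ℂ => vecPow K ψ f * star (vecPow K ψ g) :=
    fun f g => (continuous_vecPow f).mul (continuous_vecPow g).star
  have hexp : ∀ ψ : Fin d → ℂ, ‖∑ f, w f * vecPow K ψ f‖ ^ 2 =
      ∑ f, ∑ g, Complex.reCLM ((w f * star (w g)) * (vecPow K ψ f * star (vecPow K ψ g))) := by
    intro ψ
    have h1 : ((‖∑ f, w f * vecPow K ψ f‖ ^ 2 : ℝ) : ℂ) =
      ∑ f, ∑ g, ((w f * star (w g)) * (vecPow K ψ f * star (vecPow K ψ g))) := by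
      push_cast
      rw [← Complex.mul_conj', map_sum, Finset.sum_mul_sum]
      refine Finset.sum_congr rfl fun f _ => Finset.sum_congr rfl fun g _ => ?_
      rw [map_mul]
      simp only [Complex.star_def]
      ring
    have h2 := congrArg Complex.reCLM h1
    simp only [map_sum] at h2
    rw [← h2]
    simp only [Complex.reCLM_apply, Complex.ofReal_re]
  simp only [hexp]
  have hint : ∀ f g : Fin K → Fin d, Integrable (fun ψ : Fin d → ℂ =>
      Complex.reCLM ((w f * star (w g)) * (vecPow K ψ f * star (vecPow K ψ g)))) μ := fun f g =>
    integrable_cont hsupp (Complex.reCLM.continuous.comp (continuous_const.mul (hcont f g)))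
  rw [integral_finsetSum _ fun f _ => integrable_finsetSum _ fun g _ => hint f g]
  refine Finset.sum_congr rfl fun f _ => ?_
  rw [integral_finsetSum _ fun g _ => hint f g]
  refine Finset.sum_congr rfl fun g _ => ?_
  have hi2 : Integrable (fun ψ : Fin d → ℂ =>
      (w f * star (w g)) * (vecPow K ψ f * star (vecPow K ψ g))) μ :=
    integrable_cont hsupp (continuous_const.mul (hcont f g))
  rw [ContinuousLinearMap.integral_comp_comm _ hi2]
  rw [integral_const_mul]
  split_ifs with h
  · have : ∀ ψ : Fin d → ℂ, vecPow K ψ f * star (vecPow K ψ g) = ((‖vecPow K ψ f‖ ^ 2 : ℝ) : ℂ) := by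
      intro ψ
      rw [← vecPow_congr ψ h]; push_cast
      exact Complex.mul_conj' _
    simp only [this]
    rw [integral_complex_ofReal]
    simp only [Complex.reCLM_apply, Complex.re_mul_ofReal]
    rfl
  · rw [offdiag hinv h]; simp

lemma transit {d K : ℕ} {μ : Measure (Fin d → ℂ)} [IsProbabilityMeasure μ]
    (hinv : ∀ U : Matrix.unitaryGroup (Fin d) ℂ,
      Measure.map (fun ψ => Matrix.mulVec (U : Matrix (Fin d) (Fin d) ℂ) ψ) μ = μ)
    (φ : Fin d → ℝ) (i0 : Fin d) (hφ : 0 < ∑ i, φ i ^ 2) :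
    ∫ ψ, ‖(∑ i, (φ i : ℂ) * ψ i) ^ K‖ ^ 2 ∂μ = (∫ ψ, ‖ψ i0 ^ K‖ ^ 2 ∂μ) * (∑ i, φ i ^ 2) ^ K := by
  set s := ∑ i, φ i ^ 2 with hs
  set r := Real.sqrt s with hr
  have hr0 : 0 < r := Real.sqrt_pos.mpr hφ
  have hrs : r ^ 2 = s := Real.sq_sqrt hφ.le
  let u : EuclideanSpace ℂ (Fin d) := WithLp.toLp 2 fun i => ((φ i / r : ℝ) : ℂ)
  have hu : ‖u‖ = 1 := by
    rw [EuclideanSpace.norm_eq, Real.sqrt_eq_one]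
    simp only [u, Complex.norm_real, Real.norm_eq_abs, sq_abs, div_pow]
    rw [← Finset.sum_div, hrs, ← hs, div_self hφ.ne']
  have ho : Orthonormal ℂ (({i0} : Set (Fin d)).domRestrict fun _ => u) := by
    constructor
    · intro i; exact hu
    · intro i j hij; exact absurd (Subsingleton.elim i j) hij
  obtain ⟨b, hb⟩ := ho.exists_orthonormalBasis_extension_of_card_eq (by simp)
  let U : Matrix (Fin d) (Fin d) ℂ := Matrix.of fun i j => star (b i j)
  have hU : U ∈ Matrix.unitaryGroup (Fin d) ℂ := by
    rw [Matrix.mem_unitaryGroup_iff]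
    ext i j
    rw [Matrix.mul_apply, Matrix.one_apply, ← orthonormal_iff_ite.mp b.orthonormal i j]
    simp only [U, Matrix.star_apply, Matrix.of_apply, star_star, PiLp.inner_apply]
    refine Finset.sum_congr rfl fun k _ => ?_
    simp [mul_comm]
  have hcont : Continuous fun ψ : Fin d → ℂ => ‖ψ i0 ^ K‖ ^ 2 := by fun_prop
  rw [← integral_unitary_inv hinv hcont U hU, ← integral_mul_const]
  congr 1
  funext ψ
  have h1 : U.mulVec ψ i0 = ∑ i, ((φ i / r : ℝ) : ℂ) * ψ i := by
    simp only [Matrix.mulVec, dotProduct, U, Matrix.of_apply, hb i0 rfl, u]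
    refine Finset.sum_congr rfl fun k _ => ?_
    simp
  have h2 : ∑ i, (φ i : ℂ) * ψ i = r * U.mulVec ψ i0 := by
    rw [h1, Finset.mul_sum]
    refine Finset.sum_congr rfl fun k _ => ?_
    have : (r : ℂ) ≠ 0 := by exact_mod_cast hr0.ne'
    push_cast; field_simp
  rw [h2, mul_pow, norm_mul, mul_pow, mul_comm, ← hrs]
  congr 1
  rw [norm_pow, Complex.norm_real, Real.norm_eq_abs, abs_of_pos hr0]; ring

lemma prod_X_eq {d K : ℕ} (f : Fin K → Fin d) :
    (∏ k, MvPolynomial.X (f k) : MvPolynomial (Fin d) ℝ) =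
      MvPolynomial.monomial (Multiset.toFinsupp (cls f)) 1 := by
  rw [MvPolynomial.monomial_eq, Finsupp.prod_fintype _ _ (by simp)]
  simp only [map_one, one_mul, Multiset.toFinsupp_apply]
  have : (∏ k, MvPolynomial.X (f k) : MvPolynomial (Fin d) ℝ) =
    ((cls f).map MvPolynomial.X).prod := by unfold cls; rw [Multiset.map_map]; rfl
  rw [this, Finset.prod_multiset_map_count]
  refine Finset.prod_subset (Finset.subset_univ _) fun i _ hi => ?_
  rw [Multiset.count_eq_zero_of_notMem (by simpa using hi), pow_zero]

lemma ncl_mom {d K : ℕ} {μ : Measure (Fin d → ℂ)} [IsProbabilityMeasure μ]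
    (hsupp : ∀ᵐ ψ ∂μ, ∑ i, ψ i * star (ψ i) = 1)
    (hinv : ∀ U : Matrix.unitaryGroup (Fin d) ℂ,
      Measure.map (fun ψ => Matrix.mulVec (U : Matrix (Fin d) (Fin d) ℂ) ψ) μ = μ)
    (i0 : Fin d) (f0 : Fin K → Fin d) :
    ncl f0 * mom μ f0 = ∫ ψ, ‖ψ i0 ^ K‖ ^ 2 ∂μ := by
  set c := ∫ ψ, ‖ψ i0 ^ K‖ ^ 2 ∂μ with hc
  let P : MvPolynomial (Fin d) ℝ :=
    ∑ f : Fin K → Fin d, MvPolynomial.C (ncl f * mom μ f - c) * ∏ k, MvPolynomial.X (f k)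
  have hP : P = 0 := by
    refine MvPolynomial.funext_set (fun _ => Set.Ioi 0) (fun _ => Set.Ioi_infinite 0) ?_
    intro x hx
    have hx' : ∀ i, 0 < x i := fun i => hx i trivial
    let φ : Fin d → ℝ := fun i => Real.sqrt (x i)
    have hφ : ∀ i, φ i ^ 2 = x i := fun i => Real.sq_sqrt (hx' i).le
    have hpos : 0 < ∑ i, φ i ^ 2 :=
      Finset.sum_pos (fun i _ => by rw [hφ]; exact hx' i) ⟨i0, Finset.mem_univ _⟩
    have h1 := transit (K := K) hinv φ i0 hpos
    have h2 : ∀ ψ : Fin d → ℂ, (∑ i, (φ i : ℂ) * ψ i) ^ K =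
        ∑ f : Fin K → Fin d, ((∏ k, φ (f k) : ℝ) : ℂ) * vecPow K ψ f := by
      intro ψ
      rw [Fintype.sum_pow]
      refine Finset.sum_congr rfl fun f _ => ?_
      rw [Finset.prod_mul_distrib]; push_cast; rfl
    simp only [h2] at h1
    rw [quad hsupp hinv, Fintype.sum_pow, ← hc, Finset.mul_sum] at h1
    simp only [P, map_zero, map_sum, map_mul, map_prod, MvPolynomial.eval_C, MvPolynomial.eval_X]
    rw [← sub_eq_zero.mpr h1, ← Finset.sum_sub_distrib]
    refine Finset.sum_congr rfl fun f _ => ?_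
    rw [← Finset.sum_filter]
    rw [Finset.sum_congr rfl (g := fun _ => (∏ k, x (f k)) * mom μ f)]
    · rw [Finset.sum_const, nsmul_eq_mul]
      have : (Finset.univ.filter fun g : Fin K → Fin d => cls f = cls g).card = ncl f := by
        unfold ncl; simp only [eq_comm]
      rw [this]
      simp only [hφ]
      ring
    · intro g hg
      have hfg := (Finset.mem_filter.mp hg).2
      have : ∏ k, φ (g k) = ∏ k, φ (f k) := by
        have h : ∀ g : Fin K → Fin d, ∏ k, φ (g k) = ((cls g).map φ).prod := by
          intro g; unfold cls; rw [Multiset.map_map]; rfl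
        rw [h, h, hfg]
      rw [this, Complex.star_def, Complex.conj_ofReal, ← Complex.ofReal_mul, Complex.ofReal_re,
        ← Finset.prod_mul_distrib]
      simp only [← hφ, sq]
  have h3 := congrArg (MvPolynomial.coeff (Multiset.toFinsupp (cls f0))) hP
  simp only [P, prod_X_eq, MvPolynomial.coeff_sum, MvPolynomial.coeff_C_mul,
    MvPolynomial.coeff_monomial, MvPolynomial.coeff_zero, EmbeddingLike.apply_eq_iff_eq,
    mul_ite, mul_one, mul_zero] at h3
  rw [← Finset.sum_filter] at h3
  rw [Finset.sum_congr rfl (g := fun _ => ncl f0 * mom μ f0 - c)] at h3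
  · rw [Finset.sum_const, nsmul_eq_mul] at h3
    have h4 : ((Finset.univ.filter fun g : Fin K → Fin d => cls g = cls f0).card : ℝ) ≠ 0 := by
      exact_mod_cast (ncl_pos f0).ne'
    have := (mul_eq_zero.mp h3).resolve_left h4
    linarith
  · intro g hg
    have hfg := (Finset.mem_filter.mp hg).2
    rw [ncl_congr hfg, mom_congr μ hfg]

lemma sum_mom {d K : ℕ} {μ : Measure (Fin d → ℂ)} [IsProbabilityMeasure μ]
    (hsupp : ∀ᵐ ψ ∂μ, ∑ i, ψ i * star (ψ i) = 1) :
    ∑ f : Fin K → Fin d, mom μ f = 1 := by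
  unfold mom
  have hi : ∀ f : Fin K → Fin d, Integrable (fun ψ : Fin d → ℂ => ‖vecPow K ψ f‖ ^ 2) μ :=
    fun f => integrable_cont hsupp ((continuous_vecPow f).norm.pow 2)
  rw [← integral_finsetSum _ fun f _ => hi f]
  have : ∫ _ψ : Fin d → ℂ, (1 : ℝ) ∂μ = 1 := by simp
  rw [← this]
  refine integral_congr_ae ?_
  filter_upwards [hsupp] with ψ hψ
  have h2 : ∑ i, ‖ψ i‖ ^ 2 = 1 := by
    have : ((∑ i, ‖ψ i‖ ^ 2 : ℝ) : ℂ) = 1 := by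
      rw [← hψ]; push_cast
      refine Finset.sum_congr rfl fun i _ => ?_
      exact (Complex.mul_conj' _).symm
    exact_mod_cast this
  have h3 := Fintype.sum_pow (fun i => ‖ψ i‖ ^ 2) K
  rw [h2, one_pow] at h3
  rw [h3]
  refine Finset.sum_congr rfl fun f _ => ?_
  unfold vecPow
  rw [norm_prod, Finset.prod_pow]

lemma key_bound {d K : ℕ} {μ : Measure (Fin d → ℂ)} [IsProbabilityMeasure μ]
    (hsupp : ∀ᵐ ψ ∂μ, ∑ i, ψ i * star (ψ i) = 1)
    (hinv : ∀ U : Matrix.unitaryGroup (Fin d) ℂ,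
      Measure.map (fun ψ => Matrix.mulVec (U : Matrix (Fin d) (Fin d) ℂ) ψ) μ = μ)
    (i0 : Fin d) (w : (Fin K → Fin d) → ℂ) :
    ∫ ψ, ‖∑ f, w f * vecPow K ψ f‖ ^ 2 ∂μ ≤
      (1 / ((d + K - 1).choose K : ℝ)) * ∑ f, ‖w f‖ ^ 2 := by
  set c := ∫ ψ, ‖ψ i0 ^ K‖ ^ 2 ∂μ with hc
  have hcm : ∀ f : Fin K → Fin d, ncl f * mom μ f = c := ncl_mom hsupp hinv i0
  have hcT : c * ((d + K - 1).choose K : ℝ) = 1 := by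
    rw [← sum_inv_ncl, Finset.mul_sum]
    refine Eq.trans ?_ (sum_mom (K := K) hsupp)
    refine Finset.sum_congr rfl fun f _ => ?_
    rw [← hcm f]
    have : (ncl f : ℝ) ≠ 0 := by exact_mod_cast (ncl_pos f).ne'
    field_simp
  have hce : 1 / ((d + K - 1).choose K : ℝ) = c := by
    rw [div_eq_iff (right_ne_zero_of_mul_eq_one hcT), hcT]
  have hm0 : ∀ f : Fin K → Fin d, 0 ≤ mom μ f := fun f => integral_nonneg fun ψ => by positivity
  rw [hce, quad hsupp hinv]
  have hcard : ∀ f : Fin K → Fin d, (∑ g : Fin K → Fin d, if cls f = cls g then (1 : ℝ) else 0) = ncl f := by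
    intro f
    rw [Finset.sum_boole]; unfold ncl; simp only [eq_comm]
  have hA : ∑ f : Fin K → Fin d, ∑ g : Fin K → Fin d, (if cls f = cls g then ‖w f‖ ^ 2 * mom μ f else 0)
      = c * ∑ f, ‖w f‖ ^ 2 := by
    rw [Finset.mul_sum]
    refine Finset.sum_congr rfl fun f _ => ?_
    rw [← hcm f, ← hcard f, Finset.sum_mul, Finset.sum_mul]
    refine Finset.sum_congr rfl fun g _ => ?_
    split_ifs <;> ring
  have hB : ∑ f : Fin K → Fin d, ∑ g : Fin K → Fin d, (if cls f = cls g then ‖w g‖ ^ 2 * mom μ f else 0)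
      = c * ∑ f, ‖w f‖ ^ 2 := by
    rw [← hA, Finset.sum_comm]
    refine Finset.sum_congr rfl fun f _ => Finset.sum_congr rfl fun g _ => ?_
    by_cases h : cls f = cls g
    · rw [if_pos h, if_pos h.symm, mom_congr μ h]
    · rw [if_neg h, if_neg (Ne.symm h)]
  have hle : ∑ f : Fin K → Fin d, ∑ g : Fin K → Fin d,
      (if cls f = cls g then (w f * star (w g)).re * mom μ f else 0) ≤
      ∑ f : Fin K → Fin d, ∑ g : Fin K → Fin d,
      (1 / 2 : ℝ) * ((if cls f = cls g then ‖w f‖ ^ 2 * mom μ f else 0) +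
        (if cls f = cls g then ‖w g‖ ^ 2 * mom μ f else 0)) := by
    refine Finset.sum_le_sum fun f _ => Finset.sum_le_sum fun g _ => ?_
    split_ifs
    · have h1 : (w f * star (w g)).re ≤ ‖w f‖ * ‖w g‖ := by
        refine (Complex.re_le_norm _).trans ?_
        rw [norm_mul, norm_star]
      have h2 : (w f * star (w g)).re ≤ (1 / 2) * (‖w f‖ ^ 2 + ‖w g‖ ^ 2) := by
        nlinarith [sq_nonneg (‖w f‖ - ‖w g‖)]
      nlinarith [mul_le_mul_of_nonneg_right h2 (hm0 f)]
    · simp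
  refine hle.trans (le_of_eq ?_)
  simp only [← Finset.mul_sum, Finset.sum_add_distrib]
  rw [hA, hB]; ring

open scoped MatrixOrder in
lemma exists_factor {n : Type*} [Fintype n] [DecidableEq n] {A : Matrix n n ℂ} (hA : A.PosSemidef) :
    ∃ B : Matrix n n ℂ, ∀ f g, A f g = ∑ k, star (B k f) * B k g := by
  obtain ⟨X, hX, -, h⟩ := sub_zero A ▸ CFC.exists_sqrt_of_isSelfAdjoint_of_quasispectrumRestricts
    hA.isHermitian (QuasispectrumRestricts.nnreal_of_nonneg hA.nonneg)
  refine ⟨X, fun f g => ?_⟩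
  have h2 : A = star X * X := by rw [hX.star_eq]; rw [h, sub_zero]
  rw [h2, Matrix.mul_apply]
  rfl

lemma factor_one {n : Type*} [Fintype n] (A B : Matrix n n ℂ)
    (hB : ∀ f g, A f g = ∑ k, star (B k f) * B k g) (v : n → ℂ) :
    ∑ f, ∑ g, A f g * (v g * star (v f)) = ∑ k, ((‖∑ g, B k g * v g‖ ^ 2 : ℝ) : ℂ) := by
  have : ∀ k, ((‖∑ g, B k g * v g‖ ^ 2 : ℝ) : ℂ) = ∑ f, ∑ g, star (B k f) * B k g * (v g * star (v f)) := by
    intro k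
    push_cast
    rw [← Complex.conj_mul', map_sum, Finset.sum_mul_sum]
    refine Finset.sum_congr rfl fun f _ => Finset.sum_congr rfl fun g _ => ?_
    rw [map_mul]
    simp only [Complex.star_def]
    ring
  simp only [this, hB, Finset.sum_mul]
  rw [Finset.sum_comm]
  rw [Finset.sum_comm]
  conv_rhs => rw [Finset.sum_comm]
  refine Finset.sum_congr rfl fun f _ => ?_
  rw [Finset.sum_comm]

lemma factor_two {d M : ℕ} (Φ : (Fin (M + 1) → Fin d) → ℂ) (ψ : Fin d → ℂ) :
    (∑ a, ∑ b, star (ψ a) *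
          (∑ h : Fin M → Fin d, Φ (Fin.cons a h) * star (Φ (Fin.cons b h))) * ψ b) =
    ∑ h : Fin M → Fin d, ((‖∑ b, star (Φ (Fin.cons b h)) * ψ b‖ ^ 2 : ℝ) : ℂ) := by
  have : ∀ h : Fin M → Fin d, ((‖∑ b, star (Φ (Fin.cons b h)) * ψ b‖ ^ 2 : ℝ) : ℂ) =
      ∑ a, ∑ b, star (ψ a) * (Φ (Fin.cons a h) * star (Φ (Fin.cons b h))) * ψ b := by
    intro k
    push_cast
    rw [← Complex.conj_mul', map_sum, Finset.sum_mul_sum]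
    refine Finset.sum_congr rfl fun f _ => Finset.sum_congr rfl fun g _ => ?_
    rw [map_mul]
    simp only [Complex.star_def, Complex.conj_conj]
    ring
  simp only [this, Finset.mul_sum, Finset.sum_mul]
  conv_rhs => rw [Finset.sum_comm]
  refine Finset.sum_congr rfl fun f _ => ?_
  rw [Finset.sum_comm]

lemma sum_cons {d n : ℕ} {E : Type*} [AddCommMonoid E] (F : (Fin (n + 1) → Fin d) → E) :
    ∑ f, F f = ∑ b : Fin d, ∑ g : Fin n → Fin d, F (Fin.cons b g) := by
  rw [← Fintype.sum_prod_type']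
  exact (Equiv.sum_comp (Fin.consEquiv fun _ => Fin d) F).symm

/-- Product vector. -/
noncomputable def wvec {d n : ℕ} (p : (Fin n → Fin d) → ℂ) (q : Fin d → ℂ) :
    (Fin (n + 1) → Fin d) → ℂ := fun f => p (Fin.tail f) * q (f 0)

lemma wvec_sum {d n : ℕ} (p : (Fin n → Fin d) → ℂ) (q : Fin d → ℂ) (ψ : Fin d → ℂ) :
    ∑ f, wvec p q f * vecPow (n + 1) ψ f = (∑ g, p g * vecPow n ψ g) * (∑ b, q b * ψ b) := by
  rw [sum_cons, mul_comm, Finset.sum_mul_sum]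
  refine Finset.sum_congr rfl fun b _ => Finset.sum_congr rfl fun g _ => ?_
  simp only [wvec, vecPow, Fin.tail_cons, Fin.cons_zero, Fin.prod_univ_succ, Fin.cons_succ]
  ring

lemma wvec_norm {d n : ℕ} (p : (Fin n → Fin d) → ℂ) (q : Fin d → ℂ) :
    ∑ f, ‖wvec p q f‖ ^ 2 = (∑ g, ‖p g‖ ^ 2) * (∑ b, ‖q b‖ ^ 2) := by
  rw [sum_cons, mul_comm, Finset.sum_mul_sum]
  refine Finset.sum_congr rfl fun b _ => Finset.sum_congr rfl fun g _ => ?_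
  simp only [wvec, Fin.tail_cons, Fin.cons_zero, norm_mul]
  ring

open scoped ComplexOrder

/-- Optimality of the mean estimation fidelity: for any POVM `{O_r}` on
`Sym^{M+1}(ℂ^d)` with symmetric guess states `Φ_r`, the mean fidelity
`f̄ = ∫dψ Σ_r Tr[O_r |ψ⟩⟨ψ|^{⊗(M+1)}] ⟨ψ|Tr_{M}(|Φ_r⟩⟨Φ_r|)|ψ⟩` is at most
`((M+1)+1)/((M+1)+d)`.  (The paper's statement with `M ≥ 1` copies, written
here with `M+1` copies to avoid natural subtraction.) -/
theorem mean_fidelity_bound (d M R : ℕ) (μ : Measure (Fin d → ℂ))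
    [IsProbabilityMeasure μ]
    (hsupp : ∀ᵐ ψ ∂μ, ∑ i, ψ i * star (ψ i) = 1)
    (hinv : ∀ U : Matrix.unitaryGroup (Fin d) ℂ,
      Measure.map (fun ψ => Matrix.mulVec (U : Matrix (Fin d) (Fin d) ℂ) ψ) μ = μ)
    (O : Fin R → Matrix (Fin (M + 1) → Fin d) (Fin (M + 1) → Fin d) ℂ)
    (hpos : ∀ r, (O r).PosSemidef)
    (hOsym : ∀ r, symProj d (M + 1) * O r * symProj d (M + 1) = O r)
    (hcomp : ∑ r, O r = symProj d (M + 1))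
    (Φ : Fin R → (Fin (M + 1) → Fin d) → ℂ)
    (hΦunit : ∀ r, ∑ f, Φ r f * star (Φ r f) = 1)
    (hΦsym : ∀ r (σ : Equiv.Perm (Fin (M + 1))) f, Φ r (f ∘ σ) = Φ r f) :
    (∫ ψ, ∑ r,
        (∑ f, ∑ g, O r f g * (vecPow (M + 1) ψ g * star (vecPow (M + 1) ψ f))) *
        (∑ a, ∑ b, star (ψ a) *
          (∑ h : Fin M → Fin d, Φ r (Fin.cons a h) * star (Φ r (Fin.cons b h))) * ψ b)
      ∂μ).re ≤ ((M : ℝ) + 2) / ((M : ℝ) + 1 + d) := by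
  classical
  obtain ⟨i0⟩ : Nonempty (Fin d) := by
    obtain ⟨ψ, hψ⟩ := hsupp.exists
    by_contra hne
    rw [not_nonempty_iff] at hne
    simp at hψ
  choose B hB using fun r => exists_factor (hpos r)
  let q : Fin R → (Fin M → Fin d) → Fin d → ℂ := fun r h b => star (Φ r (Fin.cons b h))
  have hpt : ∀ ψ : Fin d → ℂ, (∑ r,
        (∑ f, ∑ g, O r f g * (vecPow (M + 1) ψ g * star (vecPow (M + 1) ψ f))) *
        (∑ a, ∑ b, star (ψ a) *
          (∑ h : Fin M → Fin d, Φ r (Fin.cons a h) * star (Φ r (Fin.cons b h))) * ψ b)) =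
      ((∑ r, ∑ k, ∑ h, ‖∑ f, wvec (B r k) (q r h) f * vecPow (M + 1 + 1) ψ f‖ ^ 2 : ℝ) : ℂ) := by
    intro ψ
    push_cast
    refine Finset.sum_congr rfl fun r _ => ?_
    rw [factor_one _ _ (hB r), factor_two, Finset.sum_mul_sum]
    refine Finset.sum_congr rfl fun k _ => Finset.sum_congr rfl fun h _ => ?_
    rw [wvec_sum, norm_mul]
    push_cast
    ring
  simp only [hpt]
  rw [integral_complex_ofReal, Complex.ofReal_re]
  have hint : ∀ w : (Fin (M + 1 + 1) → Fin d) → ℂ,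
      Integrable (fun ψ : Fin d → ℂ => ‖∑ f, w f * vecPow (M + 1 + 1) ψ f‖ ^ 2) μ := by
    intro w
    refine integrable_cont hsupp (Continuous.pow (Continuous.norm ?_) 2)
    exact continuous_finsetSum _ fun f _ => continuous_const.mul (continuous_vecPow f)
  rw [integral_finsetSum _ fun r _ => integrable_finsetSum _ fun k _ =>
    integrable_finsetSum _ fun h _ => hint _]
  have hΦn : ∀ r, ∑ h, ∑ b, ‖q r h b‖ ^ 2 = 1 := by
    intro r
    have h1 : ((∑ f, ‖Φ r f‖ ^ 2 : ℝ) : ℂ) = 1 := by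
      rw [← hΦunit r]; push_cast
      exact Finset.sum_congr rfl fun i _ => (Complex.mul_conj' _).symm
    have h2 : ∑ f, ‖Φ r f‖ ^ 2 = 1 := by exact_mod_cast h1
    rw [← h2, sum_cons, Finset.sum_comm]
    simp only [q, norm_star]
  have htr : ∑ r, ∑ k, ∑ g, ‖B r k g‖ ^ 2 = ((d + (M + 1) - 1).choose (M + 1) : ℝ) := by
    have h1 : ((∑ r, ∑ k, ∑ g, ‖B r k g‖ ^ 2 : ℝ) : ℂ) = (symProj d (M + 1)).trace := by
      rw [← hcomp, Matrix.trace_sum]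
      push_cast
      refine Finset.sum_congr rfl fun r _ => ?_
      unfold Matrix.trace
      simp only [Matrix.diag, hB]
      rw [Finset.sum_comm]
      exact Finset.sum_congr rfl fun i _ => Finset.sum_congr rfl fun j _ =>
        (Complex.conj_mul' _).symm
    rw [trace_symProj] at h1
    exact_mod_cast h1
  set C := ((d + (M + 1 + 1) - 1).choose (M + 1 + 1) : ℝ) with hC
  calc _ ≤ ∑ r, ∑ k, ∑ h, (1 / C) * ((∑ g, ‖B r k g‖ ^ 2) * ∑ b, ‖q r h b‖ ^ 2) := by
        refine Finset.sum_le_sum fun r _ => ?_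
        rw [integral_finsetSum _ fun k _ => integrable_finsetSum _ fun h _ => hint _]
        refine Finset.sum_le_sum fun k _ => ?_
        rw [integral_finsetSum _ fun h _ => hint _]
        refine Finset.sum_le_sum fun h _ => ?_
        rw [← wvec_norm]
        exact key_bound hsupp hinv i0 _
    _ = (1 / C) * ((d + (M + 1) - 1).choose (M + 1) : ℝ) := by
        simp only [← Finset.mul_sum, hΦn, mul_one]
        rw [htr]
    _ = _ := by
        have hd : 0 < d := i0.pos
        have e1 : d + (M + 1) - 1 = d + M := by omega
        have e2 : d + (M + 1 + 1) - 1 = d + M + 1 := by omega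
        have h3 : (d + M + 1) * (d + M).choose (M + 1) = (d + M + 1).choose (M + 1 + 1) * (M + 1 + 1) :=
          Nat.add_one_mul_choose_eq _ _
        have h3' : ((d : ℝ) + M + 1) * ((d + M).choose (M + 1) : ℝ) =
          ((d + M + 1).choose (M + 1 + 1) : ℝ) * (M + 1 + 1) := by exact_mod_cast h3
        have h4 : (0 : ℝ) < ((d + M + 1).choose (M + 1 + 1) : ℝ) := by
          exact_mod_cast Nat.choose_pos (by omega)
        rw [hC, e1, e2]
        rw [one_div_mul_eq_div, div_eq_div_iff h4.ne' (by positivity)]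
        linarith
end
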